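/- Let V be a real vector space, n ≥ 1, and let s : {1,…,2n−1} → ℝ and u, v : {1,…,2n−1} → V be arbitrary assignments. Work in the exterior algebra Λ_ℝ(V) ⊗_ℝ ℂ of ℂ-valued forms, with conjugation ξ ↦ ξ̄ given by complex conjugation on the ℂ-factor (fixing elements of V). Write ξ_j := u_j + i v_j and ξ̄_j := u_j − i v_j. Then −Alt_{2n−1} [ Σ_{k=0}^{n−1} (C(2n−1,2k+1)/(2n−1)!) · s_1 · u_2∧…∧u_{2k+1} ∧ (i v_{2k+2})∧…∧(i v_{2n−1}) ] = Alt_{2n−1} [ (η + η̄)/2 ], where η := ((−1)^n/(2n−1)!) · s_1 · ξ_2∧…∧ξ_n ∧ ξ̄_{n+1}∧…∧ξ̄_{2n−1} + Σ_{k=n+1}^{2n−1} (2(−1)^k/(2n−1)!) · s_1 · ξ_2∧…∧ξ_k ∧ ξ̄_{k+1}∧…∧ξ̄_{2n−1}, and Alt_{2n−1} acts by simultaneously permuting the triples (s_j, u_j, v_j). (This is the pointwise/formal content of the second part of Corollary 2.2: the expression for r_{2n−1}(f_1,…,f_{2n−1}), obtained by substituting s_j = log|f_j|, u_j = d log|f_j|,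 v_j = d arg f_j, with (η + η̄)/2 playing the role of the real part Re(η).) -/

import Mathlib

open TensorProduct

/-- The complexified exterior algebra `Λ_ℝ(V) ⊗_ℝ ℂ` of `ℂ`-valued forms. -/
noncomputable abbrev CForms (V : Type*) [AddCommGroup V] [Module ℝ V] : Type _ :=
  ExteriorAlgebra ℝ V ⊗[ℝ] ℂ

/-- The element `x` of `V`, viewed as a (real) `1`-form in `Λ_ℝ(V) ⊗_ℝ ℂ`. -/
noncomputable def oneForm {V : Type*} [AddCommGroup V] [Module ℝ V] (x : V) : CForms V :=
  (ExteriorAlgebra.ι ℝ x) ⊗ₜ[ℝ] (1 : ℂ)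

/-- The element `i·x` for `x ∈ V`, viewed as a `1`-form in `Λ_ℝ(V) ⊗_ℝ ℂ`. -/
noncomputable def ioneForm {V : Type*} [AddCommGroup V] [Module ℝ V] (x : V) : CForms V :=
  (ExteriorAlgebra.ι ℝ x) ⊗ₜ[ℝ] Complex.I

/-- Conjugation on `Λ_ℝ(V) ⊗_ℝ ℂ`: complex conjugation on the `ℂ`-factor, fixing `V`. -/
noncomputable def conjForm {V : Type*} [AddCommGroup V] [Module ℝ V] :
    CForms V →ₐ[ℝ] CForms V :=
  Algebra.TensorProduct.map (AlgHom.id ℝ (ExteriorAlgebra ℝ V)) Complex.conjAe.toAlgHom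

/-- The form `η := ((−1)^n/(2n−1)!) · s_1 · ξ_2∧…∧ξ_n ∧ ξ̄_{n+1}∧…∧ξ̄_{2n−1}
  + Σ_{k=n+1}^{2n−1} (2(−1)^k/(2n−1)!) · s_1 · ξ_2∧…∧ξ_k ∧ ξ̄_{k+1}∧…∧ξ̄_{2n−1}`,
where `ξ_j := u_j + i v_j`, `ξ̄_j := u_j − i v_j`, with the triples `(s_j, u_j, v_j)`
permuted by `σ` (indices written `0`-based). -/
noncomputable def eta16 {V : Type*} [AddCommGroup V] [Module ℝ V] (n : ℕ)
    (h0 : 0 < 2 * n - 1) (s : Fin (2 * n - 1) → ℝ) (u v : Fin (2 * n - 1) → V)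
    (σ : Equiv.Perm (Fin (2 * n - 1))) : CForms V :=
  (((-1 : ℝ) ^ n / ((2 * n - 1).factorial : ℝ)) * s (σ ⟨0, h0⟩)) •
    (((((List.finRange (2 * n - 1)).drop 1).take (n - 1)).map
        (fun j => oneForm (u (σ j)) + ioneForm (v (σ j)))).prod *
     (((List.finRange (2 * n - 1)).drop n).map
        (fun j => oneForm (u (σ j)) - ioneForm (v (σ j)))).prod)
  + ∑ k ∈ Finset.Icc (n + 1) (2 * n - 1),
      ((2 * (-1 : ℝ) ^ k / ((2 * n - 1).factorial : ℝ)) * s (σ ⟨0, h0⟩)) •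
        (((((List.finRange (2 * n - 1)).drop 1).take (k - 1)).map
            (fun j => oneForm (u (σ j)) + ioneForm (v (σ j)))).prod *
         (((List.finRange (2 * n - 1)).drop k).map
            (fun j => oneForm (u (σ j)) - ioneForm (v (σ j)))).prod)

open Polynomial

section PolynomialIdentity

theorem sum_range_two_mul {M : Type*} [AddCommMonoid M] (f : ℕ → M) (n : ℕ) :
    ∑ j ∈ Finset.range (2 * n), f j
      = ∑ k ∈ Finset.range n, (f (2 * k) + f (2 * k + 1)) := by
  induction n with
  | zero => simp
  | succ n ih =>
    rw [show 2 * (n + 1) = 2 * n + 1 + 1 by ring, Finset.sum_range_succ, Finset.sum_range_succ,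
      ih, Finset.sum_range_succ, add_assoc]

theorem add_pow_odd_add_sub_pow_odd {R : Type*} [CommRing R] (x : R) (p : ℕ) :
    (x + 1) ^ (2 * p + 1) + (x - 1) ^ (2 * p + 1)
      = 2 * x * ∑ k ∈ Finset.range (p + 1), ((2 * p + 1).choose (2 * k + 1) : R) * x ^ (2 * k) := by
  rw [sub_eq_add_neg, add_pow, add_pow, ← Finset.sum_add_distrib,
    show 2 * p + 1 + 1 = 2 * (p + 1) by ring, sum_range_two_mul, Finset.mul_sum]
  refine Finset.sum_congr rfl fun k hk => ?_
  have hk' : k ≤ p := by simpa [Nat.lt_succ_iff] using hk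
  have h1 : Odd (2 * p + 1 - 2 * k) := ⟨p - k, by omega⟩
  have h2 : Even (2 * p + 1 - (2 * k + 1)) := ⟨p - k, by omega⟩
  rw [h1.neg_one_pow, h2.neg_one_pow]
  ring

theorem add_mul_telescope {R : Type*} [CommRing R] (a b : R) (p r : ℕ) (hr : r ≤ p) :
    (a + b) * (∑ i ∈ Finset.range r, (-1) ^ i *
        (a ^ (p + 1 + i) * b ^ (p - 1 - i) + b ^ (p + 1 + i) * a ^ (p - 1 - i)) - a ^ p * b ^ p)
      = -((-1) ^ r * (a ^ (p + r + 1) * b ^ (p - r) + b ^ (p + r + 1) * a ^ (p - r))) := by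
  induction r with
  | zero => simp; ring
  | succ r ih =>
    obtain ⟨d, rfl⟩ : ∃ d, p = r + 1 + d := ⟨p - (r + 1), by omega⟩
    have h := ih (by omega)
    rw [Finset.sum_range_succ, add_sub_right_comm, mul_add, h]
    rw [show r + 1 + d - r = d + 1 by omega, show r + 1 + d - 1 - r = d by omega,
      show r + 1 + d - (r + 1) = d by omega]
    ring

theorem neg_sum_choose_eq (p : ℕ) :
    -∑ k ∈ Finset.range (p + 1), C ((2 * p + 1).choose (2 * k + 1) : ℝ) * X ^ (2 * k)
      = C (1 / 2) *
        ((C ((-1) ^ (p + 1)) * ((X + 1) ^ p * (X - 1) ^ p)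
          + ∑ k ∈ Finset.Icc (p + 2) (2 * p + 1),
            C (2 * (-1) ^ k) * ((X + 1) ^ (k - 1) * (X - 1) ^ (2 * p + 1 - k)))
        + (C ((-1) ^ (p + 1)) * ((X - 1) ^ p * (X + 1) ^ p)
          + ∑ k ∈ Finset.Icc (p + 2) (2 * p + 1),
            C (2 * (-1) ^ k) * ((X - 1) ^ (k - 1) * (X + 1) ^ (2 * p + 1 - k)))) := by
  have h2 : C (1 / 2 : ℝ) * 2 = 1 := by
    rw [show (2 : ℝ[X]) = C 2 from rfl, ← C_mul]; norm_num
  have hX : (2 * X : ℝ[X]) ≠ 0 := mul_ne_zero two_ne_zero X_ne_zero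
  refine mul_left_cancel₀ hX ?_
  have e1 := add_pow_odd_add_sub_pow_odd (X : ℝ[X]) p
  have e2 := add_mul_telescope (X + 1 : ℝ[X]) (X - 1) p p le_rfl
  have hI : ∀ f : ℕ → ℝ[X], ∑ k ∈ Finset.Icc (p + 2) (2 * p + 1), f k
      = ∑ i ∈ Finset.range p, f (p + 2 + i) := by
    intro f
    rw [← Finset.Ico_succ_right_eq_Icc, Finset.sum_Ico_eq_sum_range]
    congr 2
    simp; omega
  rw [hI, hI]
  have e3 : ∀ a b : ℝ[X],
      ∑ i ∈ Finset.range p, C (2 * (-1 : ℝ) ^ (p + 2 + i)) *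
        (a ^ (p + 2 + i - 1) * b ^ (2 * p + 1 - (p + 2 + i)))
      = 2 * (-1) ^ p * ∑ i ∈ Finset.range p, (-1) ^ i * (a ^ (p + 1 + i) * b ^ (p - 1 - i)) := by
    intro a b
    rw [Finset.mul_sum]
    refine Finset.sum_congr rfl fun i _ => ?_
    rw [show p + 2 + i - 1 = p + 1 + i by omega,
      show 2 * p + 1 - (p + 2 + i) = p - 1 - i by omega]
    simp only [C_mul, C_pow, C_neg, C_1, show (C 2 : ℝ[X]) = 2 from rfl]
    ring
  rw [e3, e3]
  simp only [mul_add, Finset.sum_add_distrib, Nat.sub_self, pow_zero, mul_one,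
    show p + p + 1 = 2 * p + 1 by ring] at e2
  simp only [C_pow, C_neg, C_1, pow_succ (-1 : ℝ[X]) p]
  have hs : ((-1 : ℝ[X]) ^ p) * (-1) ^ p = 1 := by rw [← mul_pow]; simp
  simp only [map_natCast]
  set S := ∑ k ∈ Finset.range (p + 1), ((2 * p + 1).choose (2 * k + 1) : ℝ[X]) * X ^ (2 * k)
  set S1 := ∑ i ∈ Finset.range p, (-1 : ℝ[X]) ^ i * ((X + 1) ^ (p + 1 + i) * (X - 1) ^ (p - 1 - i))
  set S2 := ∑ i ∈ Finset.range p, (-1 : ℝ[X]) ^ i * ((X - 1) ^ (p + 1 + i) * (X + 1) ^ (p - 1 - i))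
  set e := (-1 : ℝ[X]) ^ p
  set A := (X + 1 : ℝ[X]) ^ p
  set B := (X - 1 : ℝ[X]) ^ p
  clear_value S S1 S2 e A B
  linear_combination e1 - e * e2
    + ((X + 1) ^ (2 * p + 1) + (X - 1) ^ (2 * p + 1)) * hs
    - 2 * X * (-e * (A * B) + e * S1 + e * S2) * h2

end PolynomialIdentity

section SymmetricMultilinear

variable {M A : Type*} [AddCommGroup M] [Module ℝ M] [AddCommGroup A] [Module ℝ A]

theorem exists_perm_mem_iff_lt {m : ℕ} (S : Finset (Fin m)) :
    ∃ τ : Equiv.Perm (Fin m), ∀ i, i ∈ S ↔ (τ i : ℕ) < S.card := by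
  have hc : Fintype.card {i // i ∈ S} = Fintype.card {i : Fin m // (i : ℕ) < S.card} := by
    have hS : S.card ≤ m := by simpa using S.card_le_univ
    rw [Fintype.card_coe, Fintype.card_subtype, Fin.card_filter_val_lt]
    omega
  let e := Fintype.equivOfCardEq hc
  refine ⟨e.extendSubtype, fun i => ⟨fun hi => ?_, fun hi => ?_⟩⟩
  · exact e.extendSubtype_mem i hi
  · by_contra h
    exact e.extendSubtype_not_mem i h hi

/-- A symmetric multilinear map evaluated on linear combinations of two fixed vectors factors
linearly through the product of the corresponding linear polynomials. -/
theorem MultilinearMap.exists_polynomial_map {m : ℕ} (T : MultilinearMap ℝ (fun _ : Fin m => M) A)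
    (hT : ∀ (τ : Equiv.Perm (Fin m)) (f : Fin m → M), T (fun i => f (τ i)) = T f) (x y : M) :
    ∃ L : ℝ[X] →ₗ[ℝ] A, ∀ a b : Fin m → ℝ,
      T (fun i => a i • x + b i • y) = L (∏ i, (C (a i) * X + C (b i))) := by
  let t : ℕ → A := fun j => T (fun i => if (i : ℕ) < j then x else y)
  refine ⟨Polynomial.lsum fun j => LinearMap.toSpanSingleton ℝ A (t j), fun a b => ?_⟩
  have ht : ∀ S : Finset (Fin m), T (fun i => if i ∈ S then x else y) = t S.card := by
    intro S
    obtain ⟨τ, hτ⟩ := exists_perm_mem_iff_lt S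
    simp only [t, hτ]
    exact hT τ (fun i => if (i : ℕ) < S.card then x else y)
  have hadd := T.map_add_univ (fun i => a i • x) (fun i => b i • y)
  rw [Pi.add_def] at hadd
  rw [hadd, Finset.prod_add, _root_.map_sum]
  refine Finset.sum_congr (by simp) fun S _ => ?_
  have h1 : (S.piecewise (fun i => a i • x) fun i => b i • y)
      = fun i => (if i ∈ S then a i else b i) • (if i ∈ S then x else y) := by
    ext i; by_cases h : i ∈ S <;> simp [h]
  have h2 : ((∏ i ∈ S, (C (a i) * X)) * ∏ i ∈ Finset.univ \ S, C (b i) : ℝ[X])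
      = monomial S.card (∏ i, if i ∈ S then a i else b i) := by
    rw [Finset.prod_mul_distrib, Finset.prod_const, ← map_prod, ← map_prod,
      ← C_mul_X_pow_eq_monomial, Finset.prod_ite]
    simp only [C_mul, Finset.filter_mem_eq_inter, Finset.univ_inter, Finset.filter_notMem_eq_sdiff]
    ring
  rw [h1, h2, T.map_smul_univ, ht]
  simp

end SymmetricMultilinear

section Words

variable {V : Type*} [AddCommGroup V] [Module ℝ V]

theorem CForms.neg_smul (a : ℝ) (x : CForms V) : (-a) • x = -(a • x) :=
  _root_.neg_smul a x

theorem CForms.smul_neg (a : ℝ) (x : CForms V) : a • -x = -(a • x) :=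
  _root_.smul_neg a x

/-- The linear map `(x, y) ↦ x + i y` from `V × V` to complex `1`-forms. -/
noncomputable def complexOneForm : V × V →ₗ[ℝ] CForms V :=
  ((TensorProduct.mk ℝ (ExteriorAlgebra ℝ V) ℂ).flip 1 ∘ₗ ExteriorAlgebra.ι ℝ).coprod
    ((TensorProduct.mk ℝ (ExteriorAlgebra ℝ V) ℂ).flip Complex.I ∘ₗ ExteriorAlgebra.ι ℝ)

theorem complexOneForm_apply (w : V × V) :
    complexOneForm w = oneForm w.1 + ioneForm w.2 := rfl

theorem complexOneForm_mul_self (w : V × V) : complexOneForm w * complexOneForm w = 0 := by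
  have h : ExteriorAlgebra.ι ℝ w.1 * ExteriorAlgebra.ι ℝ w.2
      = -(ExteriorAlgebra.ι ℝ w.2 * ExteriorAlgebra.ι ℝ w.1) :=
    eq_neg_of_add_eq_zero_left (ExteriorAlgebra.ι_add_mul_swap _ _)
  simp [complexOneForm_apply, oneForm, ioneForm, add_mul, mul_add,
    Algebra.TensorProduct.tmul_mul_tmul, h, TensorProduct.neg_tmul]

/-- The wedge product of complex `1`-forms `x_j + i y_j`, as an alternating map over `ℝ`. -/
noncomputable def complexWedge (m : ℕ) : (V × V) [⋀^Fin m]→ₗ[ℝ] CForms V :=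
  (ExteriorAlgebra.lift ℝ ⟨complexOneForm, complexOneForm_mul_self⟩).toLinearMap.compAlternatingMap
    (ExteriorAlgebra.ιMulti ℝ m)

theorem complexWedge_apply {m : ℕ} (w : Fin m → V × V) :
    complexWedge m w = (List.ofFn fun i => complexOneForm (w i)).prod := by
  simp [complexWedge, ExteriorAlgebra.ιMulti_apply, map_list_prod, List.map_ofFn,
    Function.comp_def]

/-- The antisymmetrization of `s_0 · w_1 ∧ ⋯ ∧ w_m`, multilinear in the sequences `w_1, …, w_m`. -/
noncomputable def altWedge (m : ℕ) (s : Fin (m + 1) → ℝ) :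
    MultilinearMap ℝ (fun _ : Fin m => Fin (m + 1) → V × V) (CForms V) :=
  ∑ σ : Equiv.Perm (Fin (m + 1)), (Equiv.Perm.sign σ : ℤ) • s (σ 0) •
    (complexWedge m).toMultilinearMap.compLinearMap fun i => LinearMap.proj (σ i.succ)

theorem altWedge_apply {m : ℕ} (s : Fin (m + 1) → ℝ) (f : Fin m → Fin (m + 1) → V × V) :
    altWedge m s f = ∑ σ : Equiv.Perm (Fin (m + 1)), (Equiv.Perm.sign σ : ℤ) • s (σ 0) •
      complexWedge m fun i => f i (σ i.succ) := by
  rw [altWedge, _root_.sum_apply]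
  rfl

theorem altWedge_perm {m : ℕ} (s : Fin (m + 1) → ℝ) (τ : Equiv.Perm (Fin m))
    (f : Fin m → Fin (m + 1) → V × V) : altWedge m s (fun i => f (τ i)) = altWedge m s f := by
  rw [altWedge_apply, altWedge_apply]
  set τ' : Equiv.Perm (Fin (m + 1)) := Equiv.Perm.decomposeFin.symm (0, τ) with hτ'
  have hsign : Equiv.Perm.sign τ' = Equiv.Perm.sign τ := by
    simp [hτ', Equiv.Perm.decomposeFin.symm_sign]
  refine Fintype.sum_equiv (Equiv.mulRight τ'⁻¹) _ _ fun σ => ?_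
  have h0 : τ'⁻¹ 0 = 0 := by
    rw [Equiv.Perm.inv_eq_iff_eq]; simp [hτ']
  have hsucc : ∀ i : Fin m, τ'⁻¹ (τ i).succ = i.succ := by
    intro i
    rw [Equiv.Perm.inv_eq_iff_eq]; simp [hτ']
  have hw := (complexWedge m).map_perm (fun i => f i (σ (τ'⁻¹ i.succ))) τ
  simp only [Function.comp_def, hsucc] at hw
  simp only [Equiv.coe_mulRight, Equiv.Perm.mul_apply, h0, hw, Equiv.Perm.sign_mul,
    Equiv.Perm.sign_inv, hsign]
  rw [Units.smul_def, Units.val_mul, mul_smul, smul_comm (s (σ 0))]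

theorem map_take_drop_finRange_prod {R : Type*} [Monoid R] {m j : ℕ} (F G : Fin (m + 1) → R) :
    ((((List.finRange (m + 1)).drop 1).take j).map F).prod *
        (((List.finRange (m + 1)).drop (j + 1)).map G).prod
      = (List.ofFn fun i : Fin m => if (i : ℕ) < j then F i.succ else G i.succ).prod := by
  rw [← List.prod_append]
  congr 1
  refine List.ext_getElem (by simp; omega) fun i h1 h2 => ?_
  rw [List.getElem_append]
  split_ifs with h
  · have : i < j := by simp at h; omega
    simp [this]
  · have h3 : ¬ i < j := by simp at h h2; omega
    have h4 : i < m := by simpa using h2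
    simp [h3]
    congr 1
    ext
    simp
    omega

theorem prod_ite_lt {R : Type*} [CommMonoid R] {m j : ℕ} (hj : j ≤ m) (a b : R) :
    (∏ i : Fin m, if (i : ℕ) < j then a else b) = a ^ j * b ^ (m - j) := by
  rw [Finset.prod_ite, Finset.prod_const, Finset.prod_const, Fin.card_filter_val_lt,
    Finset.filter_not, Finset.card_sdiff_of_subset (Finset.filter_subset _ _),
    Fin.card_filter_val_lt, Finset.card_univ, Fintype.card_fin, min_eq_right hj]

/-- The alternating sum `F ↦ ∑ σ, sgn σ • s (σ 0) • F σ`. -/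
noncomputable def altSum {m : ℕ} (s : Fin (m + 1) → ℝ) :
    (Equiv.Perm (Fin (m + 1)) → CForms V) →ₗ[ℝ] CForms V :=
  ∑ σ : Equiv.Perm (Fin (m + 1)),
    (Equiv.Perm.sign σ : ℤ) • s (σ 0) • LinearMap.proj (R := ℝ) (φ := fun _ => CForms V) σ

theorem altSum_apply {m : ℕ} (s : Fin (m + 1) → ℝ) (F : Equiv.Perm (Fin (m + 1)) → CForms V) :
    altSum s F = ∑ σ : Equiv.Perm (Fin (m + 1)), (Equiv.Perm.sign σ : ℤ) • s (σ 0) • F σ := by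
  rw [altSum, LinearMap.sum_apply]
  rfl

/-- The product, over the indices after the first one, of `a u + b i v` for the first `j` factors
and `c u + d i v` for the remaining ones, with indices permuted by `σ`. -/
noncomputable def wedgeWord {N : ℕ} (u v : Fin N → V) (a b c d : ℝ) (j : ℕ)
    (σ : Equiv.Perm (Fin N)) : CForms V :=
  ((((List.finRange N).drop 1).take j).map
      (fun i => a • oneForm (u (σ i)) + b • ioneForm (v (σ i)))).prod *
    (((List.finRange N).drop (j + 1)).map
      (fun i => c • oneForm (u (σ i)) + d • ioneForm (v (σ i)))).prod

theorem smul_oneForm_add_smul_ioneForm (a b : ℝ) (x y : V) :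
    a • oneForm x + b • ioneForm y = complexOneForm (a • (x, (0 : V)) + b • (0, y)) := by
  simp [complexOneForm_apply, oneForm, ioneForm, TensorProduct.smul_tmul']

theorem exists_polynomial_map_wedgeWord {m : ℕ} (s : Fin (m + 1) → ℝ) (u v : Fin (m + 1) → V) :
    ∃ L : ℝ[X] →ₗ[ℝ] CForms V, ∀ j ≤ m, ∀ a b c d : ℝ,
      altSum s (wedgeWord u v a b c d j)
        = L ((C a * X + C b) ^ j * (C c * X + C d) ^ (m - j)) := by
  obtain ⟨L, hL⟩ := (altWedge m s).exists_polynomial_map (altWedge_perm s)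
    (fun i => (u i, 0)) (fun i => (0, v i))
  refine ⟨L, fun j hj a b c d => ?_⟩
  have h := hL (fun i => if (i : ℕ) < j then a else c) (fun i => if (i : ℕ) < j then b else d)
  have hprod : (∏ i : Fin m, (C (if (i : ℕ) < j then a else c) * X
      + C (if (i : ℕ) < j then b else d)) : ℝ[X])
      = (C a * X + C b) ^ j * (C c * X + C d) ^ (m - j) := by
    rw [← prod_ite_lt hj]
    refine Finset.prod_congr rfl fun i _ => ?_
    split_ifs <;> rfl
  rw [← hprod, ← h, altSum_apply, altWedge_apply]
  refine Finset.sum_congr rfl fun σ _ => ?_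
  rw [wedgeWord, map_take_drop_finRange_prod, complexWedge_apply]
  congr 4
  ext i
  simp only [smul_oneForm_add_smul_ioneForm]
  split_ifs <;> rfl

theorem conjForm_oneForm (x : V) : conjForm (oneForm x) = oneForm x := by
  simp [conjForm, oneForm]

theorem conjForm_ioneForm (x : V) : conjForm (ioneForm x) = -ioneForm x := by
  simp [conjForm, ioneForm, TensorProduct.tmul_neg]

theorem conjForm_wedgeWord {N : ℕ} (u v : Fin N → V) (a b c d : ℝ) (j : ℕ)
    (σ : Equiv.Perm (Fin N)) :
    conjForm (wedgeWord u v a b c d j σ) = wedgeWord u v a (-b) c (-d) j σ := by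
  simp [wedgeWord, map_list_prod, Function.comp_def, conjForm_oneForm, conjForm_ioneForm,
    CForms.neg_smul]

end Words

theorem alt_sum_eq_alt_re {V : Type*} [AddCommGroup V] [Module ℝ V] (p N : ℕ) (hN : N = 2 * p + 1)
    (h0 : 0 < N) (s : Fin N → ℝ) (u v : Fin N → V) (η : Equiv.Perm (Fin N) → CForms V)
    (hη : ∀ σ, η σ = (((-1 : ℝ) ^ (p + 1) / (N.factorial : ℝ)) * s (σ ⟨0, h0⟩)) •
        wedgeWord u v 1 1 1 (-1) p σ
      + ∑ k ∈ Finset.Icc (p + 2) N, ((2 * (-1 : ℝ) ^ k / (N.factorial : ℝ)) * s (σ ⟨0, h0⟩)) •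
        wedgeWord u v 1 1 1 (-1) (k - 1) σ) :
    -(∑ σ : Equiv.Perm (Fin N), (Equiv.Perm.sign σ : ℤ) • ∑ k ∈ Finset.range (p + 1),
        (((N.choose (2 * k + 1) : ℝ) / (N.factorial : ℝ)) * s (σ ⟨0, h0⟩)) •
          wedgeWord u v 1 0 0 1 (2 * k) σ)
    = ∑ σ : Equiv.Perm (Fin N), (Equiv.Perm.sign σ : ℤ) •
        ((1 / 2 : ℝ) • (η σ + conjForm (η σ))) := by
  subst hN
  obtain ⟨L, hL⟩ := exists_polynomial_map_wedgeWord s u v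
  set q : ℝ := ((2 * p + 1).factorial : ℝ)⁻¹ with hq
  have hleft : (∑ σ : Equiv.Perm (Fin (2 * p + 1)), (Equiv.Perm.sign σ : ℤ) •
      ∑ k ∈ Finset.range (p + 1),
        ((((2 * p + 1).choose (2 * k + 1) : ℝ) / ((2 * p + 1).factorial : ℝ)) * s (σ ⟨0, h0⟩)) •
          wedgeWord u v 1 0 0 1 (2 * k) σ)
      = altSum s (q • ∑ k ∈ Finset.range (p + 1),
          ((2 * p + 1).choose (2 * k + 1) : ℝ) • wedgeWord u v 1 0 0 1 (2 * k)) := by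
    rw [altSum_apply]
    refine Finset.sum_congr rfl fun σ _ => ?_
    congr 1
    rw [Pi.smul_apply, Finset.sum_apply, Finset.smul_sum, Finset.smul_sum]
    refine Finset.sum_congr rfl fun k _ => ?_
    rw [div_eq_mul_inv, ← hq, Fin.mk_zero, Pi.smul_apply, smul_smul, smul_smul]
    ring_nf
  have hright : (∑ σ : Equiv.Perm (Fin (2 * p + 1)), (Equiv.Perm.sign σ : ℤ) •
        ((1 / 2 : ℝ) • (η σ + conjForm (η σ))))
      = altSum s (q • (1 / 2 : ℝ) •
        (((-1 : ℝ) ^ (p + 1) • wedgeWord u v 1 1 1 (-1) p + ∑ k ∈ Finset.Icc (p + 2) (2 * p + 1),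
          (2 * (-1 : ℝ) ^ k) • wedgeWord u v 1 1 1 (-1) (k - 1))
        + ((-1 : ℝ) ^ (p + 1) • wedgeWord u v 1 (-1) 1 1 p + ∑ k ∈ Finset.Icc (p + 2) (2 * p + 1),
          (2 * (-1 : ℝ) ^ k) • wedgeWord u v 1 (-1) 1 1 (k - 1)))) := by
    rw [altSum_apply]
    refine Finset.sum_congr rfl fun σ _ => ?_
    simp only [hη, map_add, _root_.map_sum, map_smul, conjForm_wedgeWord, neg_neg, Pi.add_apply,
      Pi.smul_apply, Finset.sum_apply, Finset.smul_sum, smul_smul, smul_add, div_eq_mul_inv, ← hq,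
      Fin.mk_zero]
    ring_nf
  rw [hleft, hright]
  simp only [map_smul, map_add, _root_.map_sum]
  rw [← CForms.smul_neg]
  congr 1
  have hword : ∀ k ∈ Finset.range (p + 1), altSum s (wedgeWord u v 1 0 0 1 (2 * k))
      = L (X ^ (2 * k)) := fun k hk => by
    rw [hL _ (by have := Finset.mem_range.1 hk; omega)]; simp
  have hform : ∀ j ≤ 2 * p, altSum s (wedgeWord u v 1 1 1 (-1) j)
      = L ((X + 1) ^ j * (X - 1) ^ (2 * p - j)) := fun j hj => by
    rw [hL _ hj]; simp [sub_eq_add_neg]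
  have hconj : ∀ j ≤ 2 * p, altSum s (wedgeWord u v 1 (-1) 1 1 j)
      = L ((X - 1) ^ j * (X + 1) ^ (2 * p - j)) := fun j hj => by
    rw [hL _ hj]; simp [sub_eq_add_neg]
  have hid := congrArg L (neg_sum_choose_eq p)
  simp only [← smul_eq_C_mul, map_smul, map_add, map_neg, _root_.map_sum] at hid
  rw [hform p (by omega), hconj p (by omega), show 2 * p - p = p by omega]
  have hsum : ∀ (f g : ℕ → CForms V), (∀ j ≤ 2 * p, f j = g j) →
      ∑ k ∈ Finset.Icc (p + 2) (2 * p + 1), (2 * (-1 : ℝ) ^ k) • f (k - 1)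
        = ∑ k ∈ Finset.Icc (p + 2) (2 * p + 1), (2 * (-1 : ℝ) ^ k) • g (k - 1) := by
    intro f g hfg
    refine Finset.sum_congr rfl fun k hk => ?_
    rw [hfg _ (by have := Finset.mem_Icc.1 hk; omega)]
  rw [Finset.sum_congr rfl fun k hk => by rw [hword k hk], hsum _ _ hform, hsum _ _ hconj, hid]
  congr 3
  all_goals
    refine Finset.sum_congr rfl fun k hk => ?_
    rw [show 2 * p - (k - 1) = 2 * p + 1 - k by have := Finset.mem_Icc.1 hk; omega]

/-- Let `V` be a real vector space, `n ≥ 1`, and `s : {1,…,2n−1} → ℝ`,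
`u, v : {1,…,2n−1} → V` arbitrary assignments.  In `Λ_ℝ(V) ⊗_ℝ ℂ` one has
`−Alt_{2n−1} [ Σ_{k=0}^{n−1} (C(2n−1,2k+1)/(2n−1)!) · s_1 · u_2∧…∧u_{2k+1} ∧
  (i v_{2k+2})∧…∧(i v_{2n−1}) ]  =  Alt_{2n−1} [ (η + η̄)/2 ]`,
where `η` is as in `eta16` and `Alt_{2n−1}` simultaneously permutes the triples
`(s_j, u_j, v_j)`. -/
theorem stmt_16 (V : Type*) [AddCommGroup V] [Module ℝ V] (n : ℕ) (hn : 1 ≤ n)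
    (s : Fin (2 * n - 1) → ℝ) (u v : Fin (2 * n - 1) → V) :
    -(∑ σ : Equiv.Perm (Fin (2 * n - 1)), (Equiv.Perm.sign σ : ℤ) •
        ∑ k ∈ Finset.range n,
          ((((2 * n - 1).choose (2 * k + 1) : ℝ) / ((2 * n - 1).factorial : ℝ)) *
              s (σ ⟨0, by omega⟩)) •
            (((((List.finRange (2 * n - 1)).drop 1).take (2 * k)).map
                (fun j => oneForm (u (σ j)))).prod *
             (((List.finRange (2 * n - 1)).drop (2 * k + 1)).map
                (fun j => ioneForm (v (σ j)))).prod))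
    = ∑ σ : Equiv.Perm (Fin (2 * n - 1)), (Equiv.Perm.sign σ : ℤ) •
        ((1 / 2 : ℝ) •
          (eta16 n (by omega) s u v σ + conjForm (eta16 n (by omega) s u v σ))) := by
  obtain ⟨p, rfl⟩ : ∃ p, n = p + 1 := ⟨n - 1, by omega⟩
  have h := alt_sum_eq_alt_re p (2 * (p + 1) - 1) (by omega) (by omega) s u v
    (eta16 (p + 1) (by omega) s u v) fun σ => by
      rw [eta16]
      congr 1
      · simp [wedgeWord, CForms.neg_smul, sub_eq_add_neg]
      · refine Finset.sum_congr rfl fun k hk => ?_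
        rw [wedgeWord, Nat.sub_add_cancel (by have := Finset.mem_Icc.1 hk; omega)]
        simp [CForms.neg_smul, sub_eq_add_neg]
  rw [← h]
  simp [wedgeWord]
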